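/- arXiv:1603.00894 — 3 statements merged into one kernel-verified Lean document; each statement's English description precedes it below -/
import Mathlib

section
/- Let F be an ℓ-uniform hypergraph with at least one vertex contained in at least two edges, and for each n let H_n be the k-uniform hypergraph (k = e(F)) whose vertex set is the edge set of K_n^{(ℓ)} and whose edges are the edge sets of copies of F in K_n^{(ℓ)}. Then for every i ∈ [k−1] there are constants K and n₀ such that for every n ≥ n₀ and every q ≥ n^{-1/m(F)} we have μ_i(H_n, q) ≤ K·q^{2i}·n^{2v(F)−ℓ}; consequently μ_i(H_n,q) = O(q^{2i}·|E(H_n)|²/|V(H_n)|) and (H_n) is (K', (n^{-1/m(F)})_{n∈ℕ})-bounded for some K' ≥ 1. -/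
open Finset Filter

/-- The probability weight of obtaining exactly the subset `S` when each element of the
finite ground set `Γ` is included independently with probability `p`. -/
noncomputable def binomWeight {α : Type*} (Γ : Finset α) (p : ℝ) (S : Finset α) : ℝ :=
  p ^ S.card * (1 - p) ^ (Γ.card - S.card)

open Classical in
/-- The probability that the binomial random subset `Γ_p` satisfies the property `P`. -/
noncomputable def binomProb {α : Type*} (Γ : Finset α) (p : ℝ) (P : Finset α → Prop) : ℝ :=
  ∑ S ∈ Γ.powerset, if P S then binomWeight Γ p S else 0

/-- `deg_i(v, U)`: the number of edges `e` of the hypergraph with edge set `E` such that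
`v ∈ e` and `|e ∩ (U \ {v})| ≥ i`. -/
def degi {α : Type*} [DecidableEq α] (E : Finset (Finset α)) (i : ℕ) (v : α) (U : Finset α) : ℕ :=
  (E.filter fun e => v ∈ e ∧ i ≤ (e ∩ U.erase v).card).card

/-- `μ_i(H, q)`: the expected value of `∑_{v ∈ V} deg_i(v, V_q)²` for the binomial random
subset `V_q` of the vertex set `V` of the hypergraph `H = (V, E)`. -/
noncomputable def mu {α : Type*} [DecidableEq α] (V : Finset α) (E : Finset (Finset α))
    (i : ℕ) (q : ℝ) : ℝ :=
  ∑ S ∈ V.powerset, binomWeight V q S * ∑ v ∈ V, (degi E i v S : ℝ) ^ 2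

/-- A sequence of hypergraphs `(V n, E n)` is `α`-dense. -/
def AlphaDense {α : Type*} [DecidableEq α] (V : ℕ → Finset α) (E : ℕ → Finset (Finset α))
    (a : ℝ) : Prop :=
  ∀ ε : ℝ, 0 < ε → ∃ ζ : ℝ, 0 < ζ ∧ ∃ n₀ : ℕ, ∀ n ≥ n₀, ∀ U ⊆ V n,
    (a + ε) * ((V n).card : ℝ) ≤ (U.card : ℝ) →
    ζ * ((E n).card : ℝ) ≤ (((E n).filter fun e => e ⊆ U).card : ℝ)

/-- A sequence of `k`-uniform hypergraphs `(V n, E n)` is `(K, p)`-bounded. -/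
def KPBounded {α : Type*} [DecidableEq α] (k : ℕ) (V : ℕ → Finset α)
    (E : ℕ → Finset (Finset α)) (K : ℝ) (p : ℕ → ℝ) : Prop :=
  ∀ i : ℕ, 1 ≤ i → i ≤ k - 1 → ∃ n₀ : ℕ, ∀ n ≥ n₀, ∀ q : ℝ, p n ≤ q → q ≤ 1 →
    mu (V n) (E n) i q ≤ K * q ^ (2 * i) * ((E n).card : ℝ) ^ 2 / ((V n).card : ℝ)

/-- The density `d(F')` of a sub-hypergraph with `v` vertices and `e` edges, for
`ℓ`-uniform hypergraphs. -/
noncomputable def dVal (l v e : ℕ) : ℝ :=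
  if v = l then 1 / (l : ℝ) else ((e : ℝ) - 1) / ((v : ℝ) - (l : ℝ))

/-- The parameter `m(F)`: the maximum of `d(F')` over sub-hypergraphs `F' ⊆ F` with at
least one edge. -/
noncomputable def mF (l m : ℕ) (EF : Finset (Finset (Fin m))) : ℝ :=
  sSup { d : ℝ | ∃ V' : Finset (Fin m), ∃ E' ⊆ EF,
    (∀ e ∈ E', e ⊆ V') ∧ 1 ≤ E'.card ∧ d = dVal l V'.card E'.card }

/-- The edge sets of copies of `F = (Fin m, EF)` in the complete `ℓ`-uniform hypergraph
on `[n]`: the edges of the hypergraph `H_n` (whose vertices are the `ℓ`-subsets of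
`[n]`). -/
def copyEdgeSets (l m n : ℕ) (EF : Finset (Finset (Fin m))) : Finset (Finset (Finset ℕ)) :=
  ((Fintype.piFinset fun _ : Fin m => Finset.Icc 1 n).filter Function.Injective).image
    fun φ => EF.image fun e => e.image φ

/-- The binomial random subset of `V` contains a fixed `A ⊆ V` with probability `q ^ |A|`. -/
theorem sum_binomWeight_superset {α : Type*} [DecidableEq α] {V A : Finset α} (hA : A ⊆ V)
    (q : ℝ) :
    ∑ S ∈ V.powerset, binomWeight V q S * (if A ⊆ S then 1 else 0) = q ^ A.card := by
  have h := Finset.prod_add (fun _ : α => q) (fun x => if x ∈ A then 0 else 1 - q) V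
  have h1 : ∏ x ∈ V, (q + if x ∈ A then 0 else 1 - q) = q ^ A.card := by
    have : ∀ x ∈ V, (q + if x ∈ A then 0 else 1 - q) = if x ∈ A then q else 1 := by
      intro x _
      split_ifs <;> ring
    rw [Finset.prod_congr rfl this, Finset.prod_ite_mem, Finset.inter_eq_right.2 hA,
      Finset.prod_const]
  rw [← h1, h]
  refine Finset.sum_congr rfl fun S hS => ?_
  have hSV := Finset.mem_powerset.1 hS
  rw [binomWeight, Finset.prod_const, mul_assoc]
  congr 1
  split_ifs with hAS
  · rw [mul_one, ← Finset.card_sdiff_of_subset hSV, ← Finset.prod_const]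
    refine Finset.prod_congr rfl fun x hx => ?_
    rw [if_neg fun hxA => (Finset.mem_sdiff.1 hx).2 (hAS hxA)]
  · obtain ⟨x, hxA, hxS⟩ := Finset.not_subset.1 hAS
    rw [mul_zero, Finset.prod_eq_zero (Finset.mem_sdiff.2 ⟨hA hxA, hxS⟩)]
    simp [hxA]

/-- A second-moment bound for `μ_i`: if `deg_i(v, S)` is at most the number of indices `t ∈ T`
with `f t = v` and `A t ⊆ S`, then `μ_i` is at most the sum of `q ^ |A t ∪ A t'|` over the pairs
with `f t = f t'`. -/
theorem mu_le_sum_pairs {α τ : Type*} [DecidableEq α] {V : Finset α} {E : Finset (Finset α)}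
    {i : ℕ} {q : ℝ} (hq0 : 0 ≤ q) (hq1 : q ≤ 1) (T : Finset τ) (f : τ → α) (A : τ → Finset α)
    (hA : ∀ t ∈ T, A t ⊆ V)
    (hdeg : ∀ v S, degi E i v S ≤ (T.filter fun t => f t = v ∧ A t ⊆ S).card) :
    mu V E i q ≤ ∑ t ∈ T, ∑ t' ∈ T, if f t = f t' then q ^ (A t ∪ A t').card else 0 := by
  have key : ∀ S ∈ V.powerset, binomWeight V q S * ∑ v ∈ V, (degi E i v S : ℝ) ^ 2 ≤
      ∑ t ∈ T, ∑ t' ∈ T, if f t = f t' then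
        binomWeight V q S * (if A t ∪ A t' ⊆ S then 1 else 0) else 0 := by
    intro S _
    have hw : 0 ≤ binomWeight V q S :=
      mul_nonneg (pow_nonneg hq0 _) (pow_nonneg (by linarith) _)
    have h1 : ∑ v ∈ V, (degi E i v S : ℝ) ^ 2 ≤
        ∑ t ∈ T, ∑ t' ∈ T, if f t = f t' then (if A t ∪ A t' ⊆ S then (1 : ℝ) else 0) else 0 := by
      calc ∑ v ∈ V, (degi E i v S : ℝ) ^ 2
          ≤ ∑ v ∈ V, (∑ t ∈ T, if f t = v ∧ A t ⊆ S then (1 : ℝ) else 0) ^ 2 := by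
            refine Finset.sum_le_sum fun v _ => pow_le_pow_left₀ (Nat.cast_nonneg _) ?_ 2
            rw [Finset.sum_boole]
            exact_mod_cast hdeg v S
        _ = ∑ t ∈ T, ∑ t' ∈ T, ∑ v ∈ V, (if f t = v ∧ A t ⊆ S then (1 : ℝ) else 0) *
              (if f t' = v ∧ A t' ⊆ S then (1 : ℝ) else 0) := by
            simp_rw [sq, Finset.sum_mul_sum]
            rw [Finset.sum_comm]
            exact Finset.sum_congr rfl fun t _ => Finset.sum_comm
        _ ≤ _ := by
            refine Finset.sum_le_sum fun t _ => Finset.sum_le_sum fun t' _ => ?_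
            calc _ ≤ ∑ v ∈ V, (if v = f t then
                  (if f t = f t' then (if A t ∪ A t' ⊆ S then (1 : ℝ) else 0) else 0) else 0) := by
                  refine Finset.sum_le_sum fun v _ => ?_
                  by_cases h1 : f t = v ∧ A t ⊆ S
                  · by_cases h2 : f t' = v ∧ A t' ⊆ S
                    · rw [if_pos h1.1.symm, if_pos (h1.1.trans h2.1.symm),
                        if_pos (Finset.union_subset h1.2 h2.2), if_pos h1, if_pos h2, one_mul]
                    · rw [if_neg h2, mul_zero]
                      split_ifs <;> norm_num
                  · rw [if_neg h1, zero_mul]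
                    split_ifs <;> norm_num
              _ ≤ _ := by
                  rw [Finset.sum_ite_eq']
                  split_ifs <;> norm_num
    refine (mul_le_mul_of_nonneg_left h1 hw).trans (le_of_eq ?_)
    simp_rw [Finset.mul_sum, mul_ite, mul_zero]
  refine (Finset.sum_le_sum key).trans (le_of_eq ?_)
  rw [Finset.sum_comm]
  refine Finset.sum_congr rfl fun t ht => ?_
  rw [Finset.sum_comm]
  refine Finset.sum_congr rfl fun t' ht' => ?_
  split_ifs
  · exact sum_binomWeight_superset (Finset.union_subset (hA t ht) (hA t' ht')) q
  · exact Finset.sum_const_zero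

/-- The non-isolated vertices of the hypergraph with edge set `E`. -/
def coveredVertices {m : ℕ} (E : Finset (Finset (Fin m))) : Finset (Fin m) :=
  E.biUnion id

theorem subset_coveredVertices {m : ℕ} {E : Finset (Finset (Fin m))} {e : Finset (Fin m)}
    (he : e ∈ E) : e ⊆ coveredVertices E :=
  Finset.subset_biUnion_of_mem id he

theorem coveredVertices_mono {m : ℕ} {E E' : Finset (Finset (Fin m))} (h : E ⊆ E') :
    coveredVertices E ⊆ coveredVertices E' :=
  Finset.biUnion_subset_biUnion_of_subset_left id h

/-- The number of maps sending `P` into a small set `B`, the rest of `W` into `[n]`, and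
everything else to `1`. -/
theorem card_piFinset_ite_le {m n : ℕ} {P W : Finset (Fin m)} (hPW : P ⊆ W) {B : Finset ℕ}
    (hB : B.card ≤ m) :
    (Fintype.piFinset fun v => if v ∈ P then B else if v ∈ W then Finset.Icc 1 n
      else {1}).card ≤ m ^ m * n ^ (W.card - P.card) := by
  have h : ∀ v ∈ Finset.univ, (if v ∈ P then B else if v ∈ W then Finset.Icc 1 n
      else {1}).card ≤ (if v ∈ P then m else 1) * (if v ∈ W \ P then n else 1) := by
    intro v _
    by_cases hP : v ∈ P
    · simpa [hP] using hB
    · by_cases hW : v ∈ W <;> simp [hP, hW]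
  rw [Fintype.card_piFinset]
  refine (Finset.prod_le_prod (fun _ _ => Nat.zero_le _) h).trans ?_
  rw [Finset.prod_mul_distrib, Finset.prod_ite_mem, Finset.prod_ite_mem, Finset.univ_inter,
    Finset.univ_inter, Finset.prod_const, Finset.prod_const, Finset.card_sdiff_of_subset hPW]
  refine Nat.mul_le_mul_right _ ?_
  rcases Nat.eq_zero_or_pos m with rfl | hm
  · simp [Finset.eq_empty_of_isEmpty P]
  · exact Nat.pow_le_pow_right hm (by simpa using Finset.card_le_univ P)

/-- The maps `Fin m → [n]` that are injective on `W` and constantly `1` off `W`. -/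
noncomputable def injectionsOn {m : ℕ} (n : ℕ) (W : Finset (Fin m)) : Finset (Fin m → ℕ) :=
  open Classical in
  (Fintype.piFinset fun v => if v ∈ W then Finset.Icc 1 n else {1}).filter
    fun φ => Set.InjOn φ W

theorem mem_injectionsOn {m n : ℕ} {W : Finset (Fin m)} {φ : Fin m → ℕ} :
    φ ∈ injectionsOn n W ↔
      (∀ v, φ v ∈ if v ∈ W then Finset.Icc 1 n else {1}) ∧ Set.InjOn φ W := by
  simp only [injectionsOn, Finset.mem_filter, Fintype.mem_piFinset]

theorem card_injectionsOn_le {m : ℕ} (n : ℕ) (W : Finset (Fin m)) :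
    (injectionsOn n W).card ≤ m ^ m * n ^ W.card := by
  classical
  refine (Finset.card_filter_le _ _).trans ?_
  simpa using card_piFinset_ite_le (n := n) (Finset.empty_subset W) (B := ∅) (Nat.zero_le m)

/-- A map injective on `W` acts injectively on the subsets of `W`. -/
theorem injOn_image_of_injOn {α β : Type*} [DecidableEq α] [DecidableEq β] {W : Finset α}
    {φ : α → β} (hφ : Set.InjOn φ W) {E : Finset (Finset α)} (hE : ∀ e ∈ E, e ⊆ W) :
    Set.InjOn (fun e => e.image φ) (E : Set (Finset α)) := by
  intro a ha b hb hab
  have ha' : (a : Set α) ⊆ W := by exact_mod_cast hE a ha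
  have hb' : (b : Set α) ⊆ W := by exact_mod_cast hE b hb
  have h : φ '' (a : Set α) = φ '' (b : Set α) := by
    have := congrArg (fun s : Finset β => (s : Set β)) hab
    simpa using this
  exact_mod_cast (hφ.image_eq_image_iff ha' hb').1 h

theorem dVal_le_mF {l m : ℕ} {EF Y : Finset (Finset (Fin m))} (hY : Y ⊆ EF)
    (hne : Y.Nonempty) : dVal l (coveredVertices Y).card Y.card ≤ mF l m EF := by
  refine le_csSup (Set.Finite.bddAbove ?_) ⟨coveredVertices Y, Y, hY,
    fun e he => subset_coveredVertices he, hne.card_pos, rfl⟩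
  refine ((Finset.univ ×ˢ EF.powerset).image fun x : Finset (Fin m) × Finset (Finset (Fin m)) =>
    dVal l x.1.card x.2.card).finite_toSet.subset ?_
  rintro d ⟨V', E', hE', -, -, rfl⟩
  exact Finset.mem_coe.2 (Finset.mem_image.2 ⟨(V', E'), by simpa using hE', rfl⟩)

theorem mF_pos {l m : ℕ} (hl : 1 ≤ l) {EF : Finset (Finset (Fin m))}
    (hunif : ∀ e ∈ EF, e.card = l) (hne : EF.Nonempty) : 0 < mF l m EF := by
  obtain ⟨e, he⟩ := hne
  refine lt_of_lt_of_le ?_ (dVal_le_mF (l := l) (Finset.singleton_subset_iff.2 he)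
    (Finset.singleton_nonempty e))
  rw [dVal, if_pos (by simp [coveredVertices, hunif e he])]
  positivity

/-- Above the threshold `n ^ (-1 / m(F))`, every subgraph of `F` rooted at an edge has expected
number of extensions at least one. -/
theorem one_le_pow_mul_pow_of_threshold_le {l m n : ℕ} (hl : 1 ≤ l)
    {EF Y : Finset (Finset (Fin m))} (hunif : ∀ e ∈ EF, e.card = l) (hY : Y ⊆ EF)
    (hne : Y.Nonempty) (hn : 1 ≤ n) {q : ℝ} (hq : (n : ℝ) ^ (-(1 : ℝ) / mF l m EF) ≤ q) :
    1 ≤ q ^ (Y.card - 1) * (n : ℝ) ^ ((coveredVertices Y).card - l) := by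
  have hn1 : (1 : ℝ) ≤ n := by exact_mod_cast hn
  have hn0 : (0 : ℝ) < n := by linarith
  have hM := mF_pos hl hunif (hne.mono hY)
  have hYc := hne.card_pos
  have hlv : l ≤ (coveredVertices Y).card := by
    obtain ⟨e, he⟩ := hne
    rw [← hunif e (hY he)]
    exact Finset.card_le_card (subset_coveredVertices he)
  rcases hlv.eq_or_lt with h | h
  · have hY1 : Y.card ≤ 1 := by
      refine Finset.card_le_one.2 fun a ha b hb => ?_
      have hc : ∀ e ∈ Y, e = coveredVertices Y := fun e he =>
        Finset.eq_of_subset_of_card_le (subset_coveredVertices he)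
          (by rw [hunif e (hY he), ← h])
      rw [hc a ha, hc b hb]
    have : Y.card - 1 = 0 := by omega
    rw [this, ← h]
    simp
  · have hd := dVal_le_mF (l := l) hY hne
    have hlr : (l : ℝ) < (coveredVertices Y).card := by exact_mod_cast h
    rw [dVal, if_neg h.ne', div_le_iff₀ (by linarith)] at hd
    have hqp : ((n : ℝ) ^ (-(1 : ℝ) / mF l m EF)) ^ (Y.card - 1) ≤ q ^ (Y.card - 1) :=
      pow_le_pow_left₀ (by positivity) hq _
    refine le_trans ?_ (mul_le_mul_of_nonneg_right hqp (by positivity))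
    rw [← Real.rpow_natCast, ← Real.rpow_natCast, ← Real.rpow_mul hn0.le, ← Real.rpow_add hn0]
    refine Real.one_le_rpow hn1 ?_
    rw [Nat.cast_sub hlv, Nat.cast_sub (by omega : 1 ≤ Y.card), Nat.cast_one]
    have : ((Y.card : ℝ) - 1) / mF l m EF ≤ (coveredVertices Y).card - l := by
      rw [div_le_iff₀ hM]
      linarith
    have h2 : -(1 : ℝ) / mF l m EF * ((Y.card : ℝ) - 1) = -(((Y.card : ℝ) - 1) / mF l m EF) := by
      ring
    rw [h2]
    linarith

/-- For a fixed copy `φ`, the total weight of the copies `ψ` meeting it in a prescribed edge. -/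
theorem sum_overlap_le {l m n i : ℕ} (hl : 1 ≤ l) {EF : Finset (Finset (Fin m))}
    (hunif : ∀ e ∈ EF, e.card = l) (hn : 1 ≤ n) {q : ℝ}
    (hq : (n : ℝ) ^ (-(1 : ℝ) / mF l m EF) ≤ q) (hq1 : q ≤ 1)
    {g g' : Finset (Fin m)} {X X' : Finset (Finset (Fin m))} (hg : g ∈ EF) (hg' : g' ∈ EF)
    (hX : X ⊆ EF) (hX' : X' ⊆ EF) (hXi : X.card = i) (hXi' : X'.card = i) (hgX' : g' ∉ X')
    {φ : Fin m → ℕ} (hφ : φ ∈ injectionsOn n (coveredVertices EF)) :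
    (∑ ψ ∈ injectionsOn n (coveredVertices EF), if g.image φ = g'.image ψ then
      q ^ (X.image (fun e => e.image φ) ∪ X'.image (fun e => e.image ψ)).card else 0) ≤
    2 ^ EF.card * (m : ℝ) ^ m * q ^ (2 * i) * (n : ℝ) ^ ((coveredVertices EF).card - l) := by
  classical
  set W := coveredVertices EF with hW
  have hn0 : (0 : ℝ) < n := by exact_mod_cast hn
  have hq0 : 0 < q := lt_of_lt_of_le (Real.rpow_pos_of_pos hn0 _) hq
  set P : Finset (Finset (Fin m)) → Finset (Fin m) := fun Y => coveredVertices (insert g' Y)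
  set N : Finset (Finset (Fin m)) → Finset (Fin m → ℕ) := fun Y =>
    Fintype.piFinset fun v => if v ∈ P Y then W.image φ else if v ∈ W then Finset.Icc 1 n else {1}
  have hEW : ∀ e ∈ EF, e ⊆ W := fun e he => subset_coveredVertices he
  have hpoint : ∀ ψ ∈ injectionsOn n W, (if g.image φ = g'.image ψ then
      q ^ (X.image (fun e => e.image φ) ∪ X'.image (fun e => e.image ψ)).card else 0) ≤
      ∑ Y ∈ X'.powerset, if ψ ∈ N Y then q ^ (2 * i - Y.card) else 0 := by
    intro ψ hψ
    have hnn : ∀ Y ∈ X'.powerset, 0 ≤ if ψ ∈ N Y then q ^ (2 * i - Y.card) else 0 := by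
      intro Y _
      split_ifs <;> positivity
    split_ifs with hgg
    swap
    · exact Finset.sum_nonneg hnn
    set Y := X'.filter fun e => e.image ψ ∈ X.image (fun e => e.image φ) with hYdef
    have hYmem : Y ∈ X'.powerset := Finset.mem_powerset.2 (Finset.filter_subset _ _)
    refine le_trans ?_ (Finset.single_le_sum hnn hYmem)
    have hψN : ψ ∈ N Y := by
      refine Fintype.mem_piFinset.2 fun v => ?_
      split_ifs with hv hvW
      · obtain ⟨e, he, hve⟩ := Finset.mem_biUnion.1 hv
        have hve : v ∈ e := hve
        have hsub : e.image ψ ⊆ W.image φ := by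
          rcases Finset.mem_insert.1 he with rfl | he
          · rw [← hgg]
            exact Finset.image_subset_image (hEW g hg)
          · obtain ⟨x, hx, hxe⟩ := Finset.mem_image.1 (Finset.mem_filter.1 he).2
            rw [← hxe]
            exact Finset.image_subset_image (hEW x (hX hx))
        exact hsub (Finset.mem_image_of_mem ψ hve)
      · simpa [hvW] using (mem_injectionsOn.1 hψ).1 v
      · simpa [hvW] using (mem_injectionsOn.1 hψ).1 v
    rw [if_pos hψN]
    refine pow_le_pow_of_le_one hq0.le hq1 ?_
    have hφinj := injOn_image_of_injOn (mem_injectionsOn.1 hφ).2 fun e he => hEW e (hX he)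
    have hψinj := injOn_image_of_injOn (mem_injectionsOn.1 hψ).2 fun e he => hEW e (hX' he)
    have hdisj : Disjoint (X.image fun e => e.image φ) ((X' \ Y).image fun e => e.image ψ) := by
      rw [Finset.disjoint_right]
      intro a ha haX
      obtain ⟨e, he, rfl⟩ := Finset.mem_image.1 ha
      rw [Finset.mem_sdiff] at he
      exact he.2 (Finset.mem_filter.2 ⟨he.1, haX⟩)
    have hcard : i + (i - Y.card) =
        ((X.image fun e => e.image φ) ∪ (X' \ Y).image fun e => e.image ψ).card := by
      rw [Finset.card_union_of_disjoint hdisj, Finset.card_image_of_injOn hφinj,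
        Finset.card_image_of_injOn (hψinj.mono (by exact_mod_cast Finset.sdiff_subset)),
        Finset.card_sdiff_of_subset (Finset.filter_subset _ _), hXi, hXi']
    calc 2 * i - Y.card ≤ i + (i - Y.card) := by omega
      _ ≤ _ := by
        rw [hcard]
        exact Finset.card_le_card
          (Finset.union_subset_union_right (Finset.image_subset_image Finset.sdiff_subset))
  have hterm : ∀ Y ∈ X'.powerset,
      (∑ ψ ∈ injectionsOn n W, if ψ ∈ N Y then q ^ (2 * i - Y.card) else 0) ≤
      (m : ℝ) ^ m * q ^ (2 * i) * (n : ℝ) ^ (W.card - l) := by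
    intro Y hY
    have hYX := Finset.mem_powerset.1 hY
    have hins : insert g' Y ⊆ EF := Finset.insert_subset hg' (hYX.trans hX')
    have hPW : P Y ⊆ W := coveredVertices_mono hins
    have hPWc := Finset.card_le_card hPW
    have hlP : l ≤ (P Y).card := by
      rw [← hunif g' hg']
      exact Finset.card_le_card (subset_coveredVertices (Finset.mem_insert_self _ _))
    have hYi : Y.card ≤ i := hXi' ▸ Finset.card_le_card hYX
    have hthr := one_le_pow_mul_pow_of_threshold_le hl hunif hins (Finset.insert_nonempty _ _) hn hq
    rw [Finset.card_insert_of_notMem fun h => hgX' (hYX h), Nat.add_sub_cancel] at hthr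
    have hN : ((N Y).card : ℝ) ≤ (m : ℝ) ^ m * (n : ℝ) ^ (W.card - (P Y).card) := by
      exact_mod_cast card_piFinset_ite_le (n := n) hPW
        (Finset.card_image_le.trans (by simpa using Finset.card_le_univ W))
    calc _ = ((injectionsOn n W).filter fun ψ => ψ ∈ N Y).card * q ^ (2 * i - Y.card) := by
          rw [← Finset.sum_filter, Finset.sum_const, nsmul_eq_mul]
      _ ≤ (N Y).card * q ^ (2 * i - Y.card) := by
          gcongr
          exact fun ψ hψ => (Finset.mem_filter.1 hψ).2
      _ ≤ ((m : ℝ) ^ m * (n : ℝ) ^ (W.card - (P Y).card)) *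
            (q ^ (2 * i - Y.card) * (q ^ Y.card * (n : ℝ) ^ ((P Y).card - l))) := by
          refine mul_le_mul hN ?_ (by positivity) (by positivity)
          exact le_mul_of_one_le_right (by positivity) hthr
      _ = (m : ℝ) ^ m * (q ^ (2 * i - Y.card) * q ^ Y.card) *
            ((n : ℝ) ^ (W.card - (P Y).card) * (n : ℝ) ^ ((P Y).card - l)) := by ring
      _ = _ := by
          rw [← pow_add, ← pow_add, Nat.sub_add_cancel (by omega),
            Nat.sub_add_sub_cancel hPWc hlP]
  calc _ ≤ ∑ ψ ∈ injectionsOn n W, ∑ Y ∈ X'.powerset,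
        if ψ ∈ N Y then q ^ (2 * i - Y.card) else 0 := Finset.sum_le_sum hpoint
    _ ≤ ∑ Y ∈ X'.powerset, (m : ℝ) ^ m * q ^ (2 * i) * (n : ℝ) ^ (W.card - l) := by
        rw [Finset.sum_comm]
        exact Finset.sum_le_sum hterm
    _ ≤ _ := by
        rw [Finset.sum_const, nsmul_eq_mul, Finset.card_powerset, Nat.cast_pow, Nat.cast_ofNat,
          mul_assoc (2 ^ EF.card : ℝ), mul_assoc (2 ^ EF.card : ℝ)]
        gcongr
        norm_num

/-- Triples consisting of a copy of `F`, a marked edge, and `i` further edges. -/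
noncomputable def markedCopies {m : ℕ} (n i : ℕ) (EF : Finset (Finset (Fin m))) :
    Finset ((Fin m → ℕ) × Finset (Fin m) × Finset (Finset (Fin m))) :=
  injectionsOn n (coveredVertices EF) ×ˢ
    (EF ×ˢ EF.powerset).filter fun x => x.2.card = i ∧ x.1 ∉ x.2

theorem mem_markedCopies {m n i : ℕ} {EF : Finset (Finset (Fin m))} {φ : Fin m → ℕ}
    {g : Finset (Fin m)} {X : Finset (Finset (Fin m))} :
    (φ, g, X) ∈ markedCopies n i EF ↔
      φ ∈ injectionsOn n (coveredVertices EF) ∧ g ∈ EF ∧ X ⊆ EF ∧ X.card = i ∧ g ∉ X := by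
  simp only [markedCopies, Finset.mem_product, Finset.mem_filter, Finset.mem_powerset, and_assoc]

theorem degi_copyEdgeSets_le {l m n i : ℕ} {EF : Finset (Finset (Fin m))} (v : Finset ℕ)
    (S : Finset (Finset ℕ)) :
    degi (copyEdgeSets l m n EF) i v S ≤ ((markedCopies n i EF).filter fun t =>
      t.2.1.image t.1 = v ∧ t.2.2.image (fun e => e.image t.1) ⊆ S).card := by
  classical
  refine (Finset.card_le_card ?_).trans
    (Finset.card_image_le (f := fun t => EF.image fun e => e.image t.1))
  intro E hE
  obtain ⟨hE, hvE, hi⟩ := Finset.mem_filter.1 hE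
  obtain ⟨φ₀, hφ₀, rfl⟩ := Finset.mem_image.1 hE
  rw [Finset.mem_filter, Fintype.mem_piFinset] at hφ₀
  set W := coveredVertices EF
  set φ : Fin m → ℕ := fun v => if v ∈ W then φ₀ v else 1 with hφdef
  have himg : ∀ e ∈ EF, e.image φ₀ = e.image φ := fun e he =>
    Finset.image_congr fun x hx => by simp [hφdef, subset_coveredVertices he hx, W]
  have hEeq : (EF.image fun e => e.image φ₀) = EF.image fun e => e.image φ :=
    Finset.image_congr fun e he => himg e he
  have hφ : φ ∈ injectionsOn n W := by
    refine mem_injectionsOn.2 ⟨fun v => ?_, fun a ha b hb hab => ?_⟩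
    · by_cases hv : v ∈ W
      · simpa only [hφdef, if_pos hv] using hφ₀.1 v
      · simp [hφdef, hv]
    · have ha' : a ∈ W := ha
      have hb' : b ∈ W := hb
      exact hφ₀.2 (by simpa [hφdef, ha', hb'] using hab)
  rw [hEeq] at hvE hi ⊢
  obtain ⟨g, hg, hgv⟩ := Finset.mem_image.1 hvE
  obtain ⟨Z, hZ, hZi⟩ := Finset.exists_subset_card_eq hi
  obtain ⟨X, hX, hXZ⟩ := Finset.subset_image_iff.1 (hZ.trans Finset.inter_subset_left)
  have hX' : X ⊆ EF := by exact_mod_cast hX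
  have hinj := injOn_image_of_injOn (mem_injectionsOn.1 hφ).2
    fun e he => subset_coveredVertices (hX' he)
  have hXi : X.card = i := by rw [← hZi, ← hXZ, Finset.card_image_of_injOn hinj]
  have hgX : g ∉ X := fun h => by
    have h1 : g.image φ ∈ Z := hXZ ▸ Finset.mem_image_of_mem (fun e => e.image φ) h
    exact (Finset.mem_erase.1 (Finset.mem_inter.1 (hZ h1)).2).1 hgv
  refine Finset.mem_image.2 ⟨(φ, g, X), Finset.mem_filter.2 ⟨?_, hgv, ?_⟩, rfl⟩
  · exact mem_markedCopies.2 ⟨hφ, hg, hX', hXi, hgX⟩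
  · change X.image (fun e => e.image φ) ⊆ S
    rw [hXZ]
    exact (hZ.trans Finset.inter_subset_right).trans (Finset.erase_subset _ _)

theorem image_mem_powersetCard {l m n : ℕ} {EF : Finset (Finset (Fin m))}
    (hunif : ∀ e ∈ EF, e.card = l) {φ : Fin m → ℕ}
    (hφ : φ ∈ injectionsOn n (coveredVertices EF)) {e : Finset (Fin m)} (he : e ∈ EF) :
    e.image φ ∈ Finset.powersetCard l (Finset.Icc 1 n) := by
  obtain ⟨hφ1, hφ2⟩ := mem_injectionsOn.1 hφ
  have hsub := subset_coveredVertices he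
  refine Finset.mem_powersetCard.2 ⟨fun y hy => ?_, ?_⟩
  · obtain ⟨x, hx, rfl⟩ := Finset.mem_image.1 hy
    simpa only [if_pos (hsub hx)] using hφ1 x
  · rw [Finset.card_image_of_injOn (hφ2.mono (by exact_mod_cast hsub)), hunif e he]

/-- The bound on `μ_i` in terms of the number of non-isolated vertices of `F`. -/
theorem mu_copyEdgeSets_le {l m n i : ℕ} (hl : 1 ≤ l) {EF : Finset (Finset (Fin m))}
    (hunif : ∀ e ∈ EF, e.card = l) (hn : 1 ≤ n) {q : ℝ}
    (hq : (n : ℝ) ^ (-(1 : ℝ) / mF l m EF) ≤ q) (hq1 : q ≤ 1) :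
    mu (Finset.powersetCard l (Finset.Icc 1 n)) (copyEdgeSets l m n EF) i q ≤
      ((EF.card * 2 ^ EF.card) ^ 2 * (m ^ m) ^ 2 * 2 ^ EF.card : ℝ) * q ^ (2 * i) *
        ((n : ℝ) ^ (coveredVertices EF).card * (n : ℝ) ^ ((coveredVertices EF).card - l)) := by
  set W := coveredVertices EF
  set R := (EF ×ˢ EF.powerset).filter fun x => x.2.card = i ∧ x.1 ∉ x.2 with hR
  have hq0 : 0 ≤ q := le_trans (by positivity) hq
  have hRc : (R.card : ℝ) ≤ EF.card * 2 ^ EF.card := by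
    have h := Finset.card_filter_le (EF ×ˢ EF.powerset) fun x => x.2.card = i ∧ x.1 ∉ x.2
    rw [Finset.card_product, Finset.card_powerset] at h
    exact_mod_cast h
  have hΦc : ((injectionsOn n W).card : ℝ) ≤ (m : ℝ) ^ m * (n : ℝ) ^ W.card := by
    exact_mod_cast card_injectionsOn_le n W
  have hmem : ∀ x ∈ R, x.1 ∈ EF ∧ x.2 ⊆ EF ∧ x.2.card = i ∧ x.1 ∉ x.2 := by
    intro x hx
    simpa [hR, and_assoc] using hx
  set D : ℝ := 2 ^ EF.card * (m : ℝ) ^ m * q ^ (2 * i) * (n : ℝ) ^ (W.card - l)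
  have hD : 0 ≤ D := by positivity
  have hA : ∀ t ∈ markedCopies n i EF, (t.2.2.image fun e => e.image t.1) ⊆
      Finset.powersetCard l (Finset.Icc 1 n) := by
    rintro ⟨φ, g, X⟩ ht
    obtain ⟨hφ, -, hX, -⟩ := mem_markedCopies.1 ht
    exact Finset.image_subset_iff.2 fun e he => image_mem_powersetCard hunif hφ (hX he)
  have hmu := mu_le_sum_pairs hq0 hq1 (markedCopies n i EF) (fun t => t.2.1.image t.1)
    (fun t => t.2.2.image fun e => e.image t.1) hA
    (E := copyEdgeSets l m n EF) (i := i)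
    fun v S => by convert degi_copyEdgeSets_le v S
  refine hmu.trans ?_
  calc _ ≤ ∑ t ∈ markedCopies n i EF, ∑ _x ∈ R, D := by
        refine Finset.sum_le_sum fun ⟨φ, g, X⟩ ht => ?_
        obtain ⟨hφ, h1, h2, h3, -⟩ := mem_markedCopies.1 ht
        rw [markedCopies, Finset.sum_product_right]
        refine Finset.sum_le_sum fun x' hx' => ?_
        obtain ⟨h1', h2', h3', h4'⟩ := hmem _ hx'
        exact sum_overlap_le hl hunif hn hq hq1 h1 h1' h2 h2' h3 h3' h4' hφ
    _ = (injectionsOn n W).card * R.card * R.card * D := by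
        rw [Finset.sum_const, Finset.sum_const, nsmul_eq_mul, nsmul_eq_mul, markedCopies,
          Finset.card_product]
        push_cast
        ring
    _ ≤ ((m : ℝ) ^ m * (n : ℝ) ^ W.card) * (EF.card * 2 ^ EF.card) *
          (EF.card * 2 ^ EF.card) * D := by gcongr
    _ = _ := by ring

/-- Up to a constant there are at least `n ^ v` copies of `F`, where `v` is the number of
non-isolated vertices. -/
theorem pow_card_coveredVertices_le {l m n : ℕ} {EF : Finset (Finset (Fin m))}
    (hn : 1 ≤ n) (hnm : 2 * m ≤ n) :
    n ^ (coveredVertices EF).card ≤ 2 ^ m * m ^ m * (copyEdgeSets l m n EF).card := by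
  set W := coveredVertices EF
  set I := (Fintype.piFinset fun _ : Fin m => Finset.Icc 1 n).filter Function.Injective
  have hWm : W.card ≤ m := by simpa using Finset.card_le_univ W
  have hI : n ^ m ≤ 2 ^ m * I.card := by
    have h1 : n.descFactorial m ≤ I.card := by
      have hc : Fintype.card (Fin m ↪ Finset.Icc 1 n) = n.descFactorial m := by
        simp [Fintype.card_embedding_eq]
      rw [← hc, ← Finset.card_univ]
      refine Finset.card_le_card_of_injOn (fun f v => (f v : ℕ)) (fun f _ => ?_) ?_
      · refine Finset.mem_coe.2 (Finset.mem_filter.2 ⟨Fintype.mem_piFinset.2 fun v => (f v).2, ?_⟩)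
        exact Subtype.val_injective.comp f.injective
      · intro f _ f' _ h
        ext v
        exact congrFun h v
    calc n ^ m ≤ (2 * (n + 1 - m)) ^ m := Nat.pow_le_pow_left (by omega) m
      _ = 2 ^ m * (n + 1 - m) ^ m := mul_pow _ _ _
      _ ≤ 2 ^ m * I.card :=
          Nat.mul_le_mul_left _ ((Nat.pow_sub_le_descFactorial n m).trans h1)
  have hfib : I.card ≤ m ^ m * n ^ (m - W.card) * (copyEdgeSets l m n EF).card := by
    refine Finset.card_le_mul_card_image I _ fun E hE => ?_
    obtain ⟨φ, hφ, rfl⟩ := Finset.mem_image.1 hE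
    have h := card_piFinset_ite_le (n := n) (Finset.subset_univ W) (B := W.image φ)
      (Finset.card_image_le.trans hWm)
    rw [Finset.card_univ, Fintype.card_fin] at h
    refine (Finset.card_le_card fun ψ hψ => ?_).trans h
    obtain ⟨hψI, hψE⟩ := Finset.mem_filter.1 hψ
    refine Fintype.mem_piFinset.2 fun v => ?_
    split_ifs with hv hv'
    · obtain ⟨e, he, hve⟩ := Finset.mem_biUnion.1 hv
      have h1 : e.image ψ ∈ EF.image fun e => e.image φ :=
        hψE ▸ Finset.mem_image_of_mem (fun e => e.image ψ) he
      obtain ⟨x, hx, hxe⟩ := Finset.mem_image.1 h1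
      have h2 : ψ v ∈ e.image ψ := Finset.mem_image_of_mem ψ hve
      rw [← hxe] at h2
      exact Finset.image_subset_image (subset_coveredVertices hx) h2
    · exact Fintype.mem_piFinset.1 (Finset.mem_filter.1 hψI).1 v
    · exact absurd (Finset.mem_univ v) hv'
  have hpos : 0 < n ^ (m - W.card) := Nat.pow_pos hn
  refine Nat.le_of_mul_le_mul_left ?_ hpos
  calc n ^ (m - W.card) * n ^ W.card = n ^ m := by rw [← pow_add, Nat.sub_add_cancel hWm]
    _ ≤ 2 ^ m * (m ^ m * n ^ (m - W.card) * (copyEdgeSets l m n EF).card) :=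
        hI.trans (Nat.mul_le_mul_left _ hfib)
    _ = _ := by ring

/-- The hypergraph of copies of `F` in `K_n^{(ℓ)}` satisfies
`μ_i(H_n, q) ≤ K q^{2i} n^{2v(F)-ℓ}`, and consequently the sequence `(H_n)` is
`(K', (n^{-1/m(F)}))`-bounded. -/
theorem turan_hypergraph_bounded (l m : ℕ) (hl : 1 ≤ l) (EF : Finset (Finset (Fin m)))
    (hunif : ∀ e ∈ EF, e.card = l)
    (hdeg : ∃ v : Fin m, 2 ≤ (EF.filter fun e => v ∈ e).card) :
    (∀ i : ℕ, 1 ≤ i → i ≤ EF.card - 1 → ∃ K : ℝ, ∃ n₀ : ℕ, ∀ n ≥ n₀, ∀ q : ℝ,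
      (n : ℝ) ^ (-(1 : ℝ) / mF l m EF) ≤ q → q ≤ 1 →
      mu (Finset.powersetCard l (Finset.Icc 1 n)) (copyEdgeSets l m n EF) i q ≤
        K * q ^ (2 * i) * (n : ℝ) ^ (2 * m - l)) ∧
    ∃ K : ℝ, 1 ≤ K ∧
      KPBounded EF.card (fun n => Finset.powersetCard l (Finset.Icc 1 n))
        (fun n => copyEdgeSets l m n EF) K (fun n => (n : ℝ) ^ (-(1 : ℝ) / mF l m EF)) := by
  obtain ⟨v₀, hv₀⟩ := hdeg
  obtain ⟨e₀, he₀⟩ : EF.Nonempty :=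
    (Finset.card_pos.1 (by omega : 0 < (EF.filter fun e => v₀ ∈ e).card)).mono
      (Finset.filter_subset _ _)
  set W := coveredVertices EF
  have hlW : l ≤ W.card := hunif e₀ he₀ ▸ Finset.card_le_card (subset_coveredVertices he₀)
  have hWm : W.card ≤ m := by simpa using Finset.card_le_univ W
  set C : ℝ := (EF.card * 2 ^ EF.card) ^ 2 * (m ^ m) ^ 2 * 2 ^ EF.card
  have hC : 0 ≤ C := by positivity
  refine ⟨fun i _ _ => ⟨C, 1, fun n hn q hq hq1 => ?_⟩, max 1 (C * (2 ^ m * m ^ m) ^ 2),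
    le_max_left _ _, fun i _ _ => ⟨2 * m + 1, fun n hn q hq hq1 => ?_⟩⟩
  · have hq0 : 0 ≤ q := le_trans (by positivity) hq
    have hn1 : (1 : ℝ) ≤ n := by exact_mod_cast hn
    refine (mu_copyEdgeSets_le hl hunif hn hq hq1).trans ?_
    rw [← pow_add]
    have hexp : W.card + (W.card - l) ≤ 2 * m - l := by omega
    exact mul_le_mul_of_nonneg_left (pow_le_pow_right₀ hn1 hexp) (by positivity)
  · have hq0 : 0 ≤ q := le_trans (by positivity) hq
    have hn1 : 1 ≤ n := by omega
    have hn0 : (0 : ℝ) < n := by exact_mod_cast hn1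
    refine (mu_copyEdgeSets_le hl hunif hn1 hq hq1).trans ?_
    have hE : (n : ℝ) ^ W.card ≤ 2 ^ m * m ^ m * (copyEdgeSets l m n EF).card := by
      exact_mod_cast pow_card_coveredVertices_le (l := l) (EF := EF) hn1 (by omega)
    have hV : (((Finset.powersetCard l (Finset.Icc 1 n)).card : ℕ) : ℝ) = (n.choose l : ℕ) := by
      simp
    have hV0 : (0 : ℝ) < (n.choose l : ℕ) := by
      exact_mod_cast Nat.choose_pos (by omega)
    have hVn : ((n.choose l : ℕ) : ℝ) ≤ (n : ℝ) ^ l := by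
      exact_mod_cast Nat.choose_le_pow n l
    rw [hV, le_div_iff₀ hV0]
    calc _ ≤ C * q ^ (2 * i) * ((n : ℝ) ^ W.card * (n : ℝ) ^ (W.card - l)) * (n : ℝ) ^ l := by
          gcongr
      _ = C * q ^ (2 * i) * ((n : ℝ) ^ W.card) ^ 2 := by
          rw [mul_assoc _ _ ((n : ℝ) ^ l), mul_assoc _ _ ((n : ℝ) ^ l), ← pow_add,
            Nat.sub_add_cancel hlW, sq]
      _ ≤ C * q ^ (2 * i) * (2 ^ m * m ^ m * (copyEdgeSets l m n EF).card) ^ 2 := by gcongr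
      _ = C * (2 ^ m * m ^ m) ^ 2 * q ^ (2 * i) * ((copyEdgeSets l m n EF).card : ℝ) ^ 2 := by ring
      _ ≤ _ := by
          gcongr
          exact le_max_right _ _
end

section
/- For every ε > 0 there exist ζ > 0 and n₀ such that for every n ≥ n₀, every subset A ⊆ [n] with |A| ≥ (1/2 + ε)·n contains at least ζ·n² Schur triples. -/
open Finset Filter

/-- The Schur triples of `A`: unordered triples of distinct elements `x, y, z ∈ A` with
`x + y = z`, encoded as ordered triples `(x, y, z)` with `x < y`. -/
def schurTriples (A : Finset ℕ) : Finset (ℕ × ℕ × ℕ) :=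
  (A ×ˢ A ×ˢ A).filter fun t =>
    t.1 < t.2.1 ∧ t.1 ≠ t.2.2 ∧ t.2.1 ≠ t.2.2 ∧ t.1 + t.2.1 = t.2.2

/-- The elements `x < z / 2` of `A` such that `z - x` also lies in `A`. -/
def halfSummands (A : Finset ℕ) (z : ℕ) : Finset ℕ :=
  A.filter fun x => 2 * x < z ∧ z - x ∈ A

/-- Apart from those which are the smaller summand of `z`, the elements of `A` below `z` meet each
pair `{x, z - x}` at most once. -/
theorem card_filter_lt_le_card_halfSummands (A : Finset ℕ) (z : ℕ) :
    (A.filter (· < z)).card ≤ (halfSummands A z).card + (z / 2 + 1) := by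
  have h : (A.filter (· < z) \ halfSummands A z).card ≤ (Finset.range (z / 2 + 1)).card := by
    apply Finset.card_le_card_of_injOn (fun x => min x (z - x))
    · intro x hx
      simp only [Finset.coe_range, Set.mem_Iio]
      omega
    · intro x hx y hy hxy
      simp only [halfSummands, Finset.coe_sdiff, Finset.coe_filter, Set.mem_sdiff,
        Set.mem_ofPred_eq, not_and] at hx hy hxy
      obtain ⟨⟨hxA, hxz⟩, hx⟩ := hx
      obtain ⟨⟨hyA, hyz⟩, hy⟩ := hy
      by_contra hne
      have hsum : z - x = y ∧ z - y = x := by omega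
      rw [hsum.1] at hx
      rw [hsum.2] at hy
      rcases lt_or_gt_of_ne hne with hlt | hlt
      · exact hx hxA (by omega) hyA
      · exact hy hyA (by omega) hxA
  have h' := Finset.card_le_card_sdiff_add_card (s := A.filter (· < z)) (t := halfSummands A z)
  rw [Finset.card_range] at h
  omega

/-- All but `m` elements of `A` have at least `m` elements of `A` below them. -/
theorem card_le_card_filter_le_card_filter_lt (A : Finset ℕ) (m : ℕ) :
    A.card ≤ (A.filter fun z => m ≤ (A.filter (· < z)).card).card + m := by
  have h : (A.filter fun z => ¬ m ≤ (A.filter (· < z)).card).card ≤ (Finset.range m).card := by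
    apply Finset.card_le_card_of_injOn (fun z => (A.filter (· < z)).card)
    · intro z hz
      simpa using (Finset.mem_filter.1 hz).2
    · have key : ∀ x ∈ A, ∀ y, x < y → (A.filter (· < x)).card < (A.filter (· < y)).card := by
        intro x hx y hxy
        apply Finset.card_lt_card
        rw [Finset.ssubset_iff_of_subset]
        · exact ⟨x, by simp [hx, hxy], by simp⟩
        · intro w hw
          simp only [Finset.mem_filter] at hw ⊢
          exact ⟨hw.1, hw.2.trans hxy⟩
      intro x hx y hy hxy
      by_contra hne
      rcases lt_or_gt_of_ne hne with hlt | hlt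
      · exact (key x (Finset.mem_filter.1 hx).1 y hlt).ne hxy
      · exact (key y (Finset.mem_filter.1 hy).1 x hlt).ne hxy.symm
  have h' := Finset.card_filter_add_card_filter_not (s := A)
    (fun z => m ≤ (A.filter (· < z)).card)
  rw [Finset.card_range] at h
  omega

theorem mul_le_card_schurTriples {A : Finset ℕ} {n : ℕ} (hA : A ⊆ Finset.Icc 1 n) (m : ℕ) :
    (A.card - m) * (m - (n / 2 + 1)) ≤ (schurTriples A).card := by
  set T := A.filter fun z => m ≤ (A.filter (· < z)).card with hT
  have hTcard : A.card - m ≤ T.card :=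
    Nat.sub_le_iff_le_add.2 (card_le_card_filter_le_card_filter_lt A m)
  have hS : ∀ z ∈ T, m - (n / 2 + 1) ≤ (halfSummands A z).card := by
    intro z hz
    obtain ⟨hzA, hz⟩ := Finset.mem_filter.1 hz
    have hzn := (Finset.mem_Icc.1 (hA hzA)).2
    have := card_filter_lt_le_card_halfSummands A z
    omega
  calc (A.card - m) * (m - (n / 2 + 1)) ≤ T.card * (m - (n / 2 + 1)) :=
        Nat.mul_le_mul_right _ hTcard
    _ ≤ ∑ z ∈ T, (halfSummands A z).card := by
        simpa using Finset.card_nsmul_le_sum T _ _ hS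
    _ = (T.sigma fun z => halfSummands A z).card := (Finset.card_sigma _ _).symm
    _ ≤ (schurTriples A).card := by
        apply Finset.card_le_card_of_injOn fun p => (p.2, p.1 - p.2, p.1)
        · rintro ⟨z, x⟩ h
          simp only [Finset.mem_coe, Finset.mem_sigma, halfSummands, hT, Finset.mem_filter] at h
          obtain ⟨⟨hzA, -⟩, hxA, hxz, hyA⟩ := h
          have hx := (Finset.mem_Icc.1 (hA hxA)).1
          simp only [schurTriples, Finset.mem_coe, Finset.mem_filter, Finset.mem_product]
          exact ⟨⟨hxA, hyA, hzA⟩, by omega, by omega, by omega, by omega⟩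
        · rintro ⟨z, x⟩ - ⟨z', x'⟩ - h
          simp only [Prod.mk.injEq] at h
          obtain ⟨rfl, -, rfl⟩ := h
          rfl

/-- Supersaturation for Schur triples: every subset of `[n]` of density greater than `1/2`
contains quadratically many Schur triples. -/
theorem schur_supersaturation (ε : ℝ) (hε : 0 < ε) :
    ∃ ζ : ℝ, 0 < ζ ∧ ∃ n₀ : ℕ, ∀ n ≥ n₀, ∀ A ⊆ Finset.Icc 1 n,
      (1 / 2 + ε) * (n : ℝ) ≤ (A.card : ℝ) →
      ζ * (n : ℝ) ^ 2 ≤ ((schurTriples A).card : ℝ) := by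
  refine ⟨ε ^ 2 / 16, by positivity, ⌈4 / ε⌉₊, fun n hn A hA hcard => ?_⟩
  have hn' : 4 ≤ ε * n := by
    have h := Nat.ceil_le.1 hn
    rw [div_le_iff₀ hε] at h
    linarith
  set m := ⌈(1 / 2 + ε / 2) * (n : ℝ)⌉₊
  have hm : (1 / 2 + ε / 2) * (n : ℝ) ≤ m := Nat.le_ceil _
  have hm' : (m : ℝ) < (1 / 2 + ε / 2) * (n : ℝ) + 1 := Nat.ceil_lt_add_one (by positivity)
  have hhalf : ((n / 2 : ℕ) : ℝ) ≤ (n : ℝ) / 2 := Nat.cast_div_le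
  have hfst : ε / 4 * n ≤ ((A.card - m : ℕ) : ℝ) := by
    have h : (A.card : ℝ) ≤ ((A.card - m : ℕ) : ℝ) + m := by
      exact_mod_cast Nat.sub_le_iff_le_add.1 le_rfl
    linarith
  have hsnd : ε / 4 * n ≤ ((m - (n / 2 + 1) : ℕ) : ℝ) := by
    have h : (m : ℝ) ≤ ((m - (n / 2 + 1) : ℕ) : ℝ) + ((n / 2 : ℕ) + 1) := by
      exact_mod_cast Nat.sub_le_iff_le_add.1 le_rfl
    linarith
  calc ε ^ 2 / 16 * (n : ℝ) ^ 2 = (ε / 4 * n) * (ε / 4 * n) := by ring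
    _ ≤ ((A.card - m : ℕ) : ℝ) * ((m - (n / 2 + 1) : ℕ) : ℝ) := by gcongr
    _ ≤ ((schurTriples A).card : ℝ) := by exact_mod_cast mul_le_card_schurTriples hA m
end

section
/- Let ε ∈ (0,1/2) and set c = a sufficiently small positive constant (depending on ε). For every sequence of probabilities q = (q_n)_{n∈ℕ} with q_n ≤ c·n^{-1/2} for all n, the probability that every subset Y of the binomial random subset [n]_{q_n} with |Y| ≥ (1/2+ε)|[n]_{q_n}| contains a Schur triple tends to 0 as n → ∞. -/
open Finset Filter

/-- `Y` contains a Schur triple: three distinct elements `x, y, z` with `x + y = z`. -/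
def HasSchurTriple (Y : Finset ℕ) : Prop :=
  ∃ x ∈ Y, ∃ y ∈ Y, ∃ z ∈ Y, x ≠ y ∧ x ≠ z ∧ y ≠ z ∧ x + y = z

section BinomialSubset

variable {α ι : Type*}

/-- The expectation of `f` over the binomial random subset `Γ_p`. -/
noncomputable def binomMean (Γ : Finset α) (p : ℝ) (f : Finset α → ℝ) : ℝ :=
  ∑ S ∈ Γ.powerset, binomWeight Γ p S * f S

lemma binomWeight_nonneg {Γ : Finset α} {p : ℝ} (h0 : 0 ≤ p) (h1 : p ≤ 1) (S : Finset α) :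
    0 ≤ binomWeight Γ p S :=
  mul_nonneg (pow_nonneg h0 _) (pow_nonneg (sub_nonneg.2 h1) _)

lemma binomProb_nonneg {Γ : Finset α} {p : ℝ} (h0 : 0 ≤ p) (h1 : p ≤ 1)
    (P : Finset α → Prop) : 0 ≤ binomProb Γ p P := by
  classical
  refine sum_nonneg fun S _ => ?_
  split_ifs
  exacts [binomWeight_nonneg h0 h1 S, le_rfl]

/-- The Markov inequality. -/
lemma binomProb_le_binomMean {Γ : Finset α} {p : ℝ} (h0 : 0 ≤ p) (h1 : p ≤ 1)
    {P : Finset α → Prop} {f : Finset α → ℝ} (hf : ∀ S, 0 ≤ f S)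
    (hP : ∀ S ⊆ Γ, P S → 1 ≤ f S) : binomProb Γ p P ≤ binomMean Γ p f := by
  classical
  refine sum_le_sum fun S hS => ?_
  have hw := binomWeight_nonneg (Γ := Γ) h0 h1 S
  split_ifs with h
  · exact le_mul_of_one_le_right hw (hP S (mem_powerset.1 hS) h)
  · exact mul_nonneg hw (hf S)

lemma binomMean_add (Γ : Finset α) (p : ℝ) (f g : Finset α → ℝ) :
    binomMean Γ p (fun S => f S + g S) = binomMean Γ p f + binomMean Γ p g := by
  simp only [binomMean, mul_add, sum_add_distrib]

lemma binomMean_const_mul (Γ : Finset α) (p a : ℝ) (f : Finset α → ℝ) :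
    binomMean Γ p (fun S => a * f S) = a * binomMean Γ p f := by
  simp only [binomMean, mul_sum]
  exact sum_congr rfl fun S _ => by ring

lemma binomMean_sum (Γ : Finset α) (p : ℝ) (I : Finset ι) (f : ι → Finset α → ℝ) :
    binomMean Γ p (fun S => ∑ i ∈ I, f i S) = ∑ i ∈ I, binomMean Γ p (f i) := by
  simp only [binomMean, mul_sum]
  exact sum_comm

lemma binomMean_subset [DecidableEq α] {Γ : Finset α} (p : ℝ) {T : Finset α} (hT : T ⊆ Γ) :
    binomMean Γ p (fun S => if T ⊆ S then 1 else 0) = p ^ T.card := by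
  have key := prod_add (fun _ : α => p) (fun i => if i ∈ T then 0 else 1 - p) Γ
  have hprod : ∏ i ∈ Γ, (p + if i ∈ T then 0 else 1 - p) = p ^ T.card := by
    have : ∀ i ∈ Γ, (p + if i ∈ T then 0 else 1 - p) = if i ∈ T then p else 1 := by
      intro i _
      split_ifs <;> ring
    rw [prod_congr rfl this, prod_ite_mem, inter_eq_right.2 hT, prod_const]
  rw [← hprod, key]
  refine sum_congr rfl fun S hS => ?_
  have hS := mem_powerset.1 hS
  rw [prod_const, binomWeight, mul_assoc]
  congr 1
  by_cases h : T ⊆ S <;> simp only [h, if_true, if_false]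
  · rw [mul_one, ← card_sdiff_of_subset hS, ← prod_const]
    refine prod_congr rfl fun i hi => ?_
    rw [if_neg fun hiT => (mem_sdiff.1 hi).2 (h hiT)]
  · obtain ⟨i, hiT, hiS⟩ := not_subset.1 h
    rw [mul_zero]
    refine (prod_eq_zero (i := i) ?_ ?_).symm
    · exact Finset.mem_sdiff.2 ⟨hT hiT, hiS⟩
    · exact if_pos hiT

lemma binomMean_const (Γ : Finset α) (p a : ℝ) : binomMean Γ p (fun _ => a) = a := by
  classical
  simpa using (binomMean_const_mul Γ p a (fun S => if ∅ ⊆ S then 1 else 0)).trans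
    (by rw [binomMean_subset p (empty_subset Γ), card_empty, pow_zero, mul_one])

/-- The number of members of the family `T` that are contained in `S`. -/
def containedCount [DecidableEq α] (I : Finset ι) (T : ι → Finset α) (S : Finset α) : ℝ :=
  ∑ i ∈ I, if T i ⊆ S then 1 else 0

lemma containedCount_eq_card [DecidableEq α] (I : Finset ι) (T : ι → Finset α) (S : Finset α) :
    containedCount I T S = (#{i ∈ I | T i ⊆ S} : ℝ) := by
  simp [containedCount]

lemma binomMean_containedCount [DecidableEq α] {Γ : Finset α} (p : ℝ) {I : Finset ι}
    {T : ι → Finset α} (hT : ∀ i ∈ I, T i ⊆ Γ) :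
    binomMean Γ p (containedCount I T) = ∑ i ∈ I, p ^ (T i).card :=
  (binomMean_sum Γ p I _).trans (sum_congr rfl fun i hi => binomMean_subset p (hT i hi))

lemma binomMean_containedCount_sub_sq [DecidableEq α] {Γ : Finset α} (p : ℝ) {I : Finset ι}
    {T : ι → Finset α} (hT : ∀ i ∈ I, T i ⊆ Γ) :
    binomMean Γ p (fun S => (containedCount I T S - ∑ i ∈ I, p ^ (T i).card) ^ 2) =
      ∑ i ∈ I, ∑ j ∈ I, (p ^ (T i ∪ T j).card - p ^ (T i).card * p ^ (T j).card) := by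
  set μ := ∑ i ∈ I, p ^ (T i).card with hμ
  have hsq : ∀ S, (containedCount I T S - μ) ^ 2 =
      ((∑ i ∈ I, ∑ j ∈ I, if T i ∪ T j ⊆ S then 1 else 0) + (-2 * μ) * containedCount I T S)
        + μ ^ 2 := by
    intro S
    have : containedCount I T S * containedCount I T S =
        ∑ i ∈ I, ∑ j ∈ I, if T i ∪ T j ⊆ S then 1 else 0 := by
      rw [containedCount, sum_mul_sum]
      refine sum_congr rfl fun i _ => sum_congr rfl fun j _ => ?_
      by_cases h1 : T i ⊆ S <;> by_cases h2 : T j ⊆ S <;> simp [h1, h2, union_subset_iff]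
    rw [← this]
    ring
  simp only [hsq]
  rw [binomMean_add, binomMean_add, binomMean_const, binomMean_const_mul,
    binomMean_containedCount p hT, binomMean_sum]
  have hmean : ∀ i ∈ I, binomMean Γ p (fun S => ∑ j ∈ I, if T i ∪ T j ⊆ S then 1 else 0) =
      ∑ j ∈ I, p ^ (T i ∪ T j).card := fun i hi => by
    rw [binomMean_sum]
    exact sum_congr rfl fun j hj => binomMean_subset p (union_subset (hT i hi) (hT j hj))
  rw [sum_congr rfl hmean]
  simp only [sum_sub_distrib]
  rw [← sum_mul_sum, ← hμ]
  ring

lemma binomMean_card_sub_sq [DecidableEq α] (Γ : Finset α) (p : ℝ) :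
    binomMean Γ p (fun S => ((S.card : ℝ) - Γ.card * p) ^ 2) = Γ.card * (p - p ^ 2) := by
  have h := binomMean_containedCount_sub_sq (Γ := Γ) p (I := Γ) (T := fun i => {i})
    (fun i hi => singleton_subset_iff.2 hi)
  have hr : ∀ i ∈ Γ, ∑ j ∈ Γ, (p ^ (({i} : Finset α) ∪ {j}).card
      - p ^ ({i} : Finset α).card * p ^ ({j} : Finset α).card) = p - p ^ 2 := by
    intro i hi
    rw [sum_eq_single i]
    · simp; ring
    · intro j _ hj
      rw [card_union_of_disjoint (by simpa using hj.symm), pow_add, sub_self]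
    · exact fun h => absurd hi h
  rw [sum_congr rfl hr, sum_const, nsmul_eq_mul] at h
  rw [← h]
  refine sum_congr rfl fun S hS => ?_
  have hS := mem_powerset.1 hS
  have : {i ∈ Γ | i ∈ S} = S := by rw [filter_mem_eq_inter, inter_eq_right.2 hS]
  simp [containedCount_eq_card, this]

end BinomialSubset

section SchurTriples

/-- The pairs `x < y` whose sum is at most `n`; they index the Schur triples in `[n]`. -/
def schurPairs (n : ℕ) : Finset (ℕ × ℕ) :=
  {t ∈ Icc 1 n ×ˢ Icc 1 n | t.1 < t.2 ∧ t.1 + t.2 ≤ n}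

/-- The Schur triple with summands `t.1` and `t.2`. -/
def schurTriple (t : ℕ × ℕ) : Finset ℕ := {t.1, t.2, t.1 + t.2}

lemma mem_schurPairs {n : ℕ} {t : ℕ × ℕ} :
    t ∈ schurPairs n ↔ 1 ≤ t.1 ∧ t.1 < t.2 ∧ t.1 + t.2 ≤ n := by
  simp only [schurPairs, mem_filter, mem_product, mem_Icc]
  omega

lemma schurTriple_subset {n : ℕ} {t : ℕ × ℕ} (ht : t ∈ schurPairs n) :
    schurTriple t ⊆ Icc 1 n := by
  rw [mem_schurPairs] at ht
  intro v hv
  simp only [schurTriple, mem_insert, mem_singleton] at hv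
  rw [mem_Icc]
  omega

lemma card_schurTriple {n : ℕ} {t : ℕ × ℕ} (ht : t ∈ schurPairs n) :
    (schurTriple t).card = 3 := by
  rw [mem_schurPairs] at ht
  exact card_eq_three.2 ⟨_, _, _, by omega, by omega, by omega, rfl⟩

lemma card_schurPairs_le (n : ℕ) : (schurPairs n).card ≤ n ^ 2 :=
  (card_filter_le _ _).trans (by simp [sq])

lemma card_schurPairs_filter_mem_le (n v : ℕ) :
    #{t ∈ schurPairs n | v ∈ schurTriple t} ≤ 3 * n := by
  have hsub : {t ∈ schurPairs n | v ∈ schurTriple t} ⊆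
      ((Icc 1 n).image fun y => (v, y)) ∪ ((Icc 1 n).image fun x => (x, v)) ∪
        ((Icc 1 n).image fun x => (x, v - x)) := by
    rintro ⟨x, y⟩ h
    simp only [mem_filter, mem_schurPairs, schurTriple, mem_insert, mem_singleton] at h
    obtain ⟨⟨h1, h2, h3⟩, rfl | rfl | rfl⟩ := h <;>
      simp only [mem_union, mem_image, mem_Icc, Prod.mk.injEq]
    · exact .inl (.inl ⟨y, by omega, by simp⟩)
    · exact .inl (.inr ⟨x, by omega, by simp⟩)
    · exact .inr ⟨x, by omega, rfl, by omega⟩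
  have hcard : ∀ f : ℕ → ℕ × ℕ, #((Icc 1 n).image f) ≤ n := fun f =>
    card_image_le.trans (by simp)
  refine (card_le_card hsub).trans ((card_union_le _ _).trans ?_)
  have h1 := card_union_le ((Icc 1 n).image fun y => (v, y)) ((Icc 1 n).image fun x => (x, v))
  have h2 := hcard fun y => (v, y)
  have h3 := hcard fun x => (x, v)
  have h4 := hcard fun x => (x, v - x)
  omega

lemma card_schurPairs_filter_mem_mem_le (n : ℕ) {u v : ℕ} (huv : u ≠ v) :
    #{t ∈ schurPairs n | u ∈ schurTriple t ∧ v ∈ schurTriple t} ≤ 6 := by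
  have hsub : {t ∈ schurPairs n | u ∈ schurTriple t ∧ v ∈ schurTriple t} ⊆
      {(u, v), (v, u), (u, v - u), (v - u, u), (v, u - v), (u - v, v)} := by
    rintro ⟨x, y⟩ h
    simp only [mem_filter, mem_schurPairs, schurTriple, mem_insert, mem_singleton] at h
    simp only [mem_insert, mem_singleton, Prod.mk.injEq]
    omega
  exact (card_le_card hsub).trans card_le_six

lemma exists_subset_not_hasSchurTriple {n : ℕ} {S : Finset ℕ} (hS : S ⊆ Icc 1 n) :
    ∃ Y ⊆ S, ¬ HasSchurTriple Y ∧
      (S.card : ℝ) - containedCount (schurPairs n) schurTriple S ≤ Y.card := by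
  set R := {t ∈ schurPairs n | schurTriple t ⊆ S}
  refine ⟨S \ R.image Prod.fst, sdiff_subset, ?_, ?_⟩
  · have key : ∀ x y, x ∈ S \ R.image Prod.fst → y ∈ S → x + y ∈ S → x < y → False := by
      intro x y hx hy hz hxy
      rw [Finset.mem_sdiff] at hx
      refine hx.2 (mem_image.2 ⟨(x, y), mem_filter.2 ⟨mem_schurPairs.2 ?_, ?_⟩, rfl⟩)
      · have hx1 := mem_Icc.1 (hS hx.1)
        have hz1 := mem_Icc.1 (hS hz)
        exact ⟨hx1.1, hxy, hz1.2⟩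
      · simp [schurTriple, insert_subset_iff, hx.1, hy, hz]
    rintro ⟨x, hx, y, hy, z, hz, hxy, -, -, rfl⟩
    rcases lt_or_gt_of_ne hxy with h | h
    · exact key x y hx (mem_sdiff.1 hy).1 (mem_sdiff.1 hz).1 h
    · exact key y x hy (mem_sdiff.1 hx).1 (add_comm x y ▸ (mem_sdiff.1 hz).1) h
  · have h1 := le_card_sdiff (R.image Prod.fst) S
    have h2 : #(R.image Prod.fst) ≤ #R := card_image_le
    have h3 : S.card ≤ (S \ R.image Prod.fst).card + #R := by omega
    rw [containedCount_eq_card, sub_le_iff_le_add]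
    exact_mod_cast h3

lemma covariance_le {α : Type*} [DecidableEq α] {A B : Finset α} (hA : A.card = 3)
    (hB : B.card = 3) {p : ℝ} (h0 : 0 ≤ p) (h1 : p ≤ 1) :
    p ^ (A ∪ B).card - p ^ A.card * p ^ B.card ≤
      (A ∩ B).card * p ^ 5 + (A ∩ B).offDiag.card * p ^ 3 := by
  have hc := card_union_add_card_inter A B
  have hle : (A ∩ B).card ≤ 3 := hA ▸ card_le_card inter_subset_left
  rw [offDiag_card]
  generalize (A ∩ B).card = k at *
  have hu : (A ∪ B).card = 6 - k := by omega
  rw [hu, hA, hB]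
  have h3 : 0 ≤ p ^ 3 := pow_nonneg h0 3
  have h43 : p ^ 4 ≤ p ^ 3 := pow_le_pow_of_le_one h0 h1 (by norm_num)
  have h5 : 0 ≤ p ^ 5 := pow_nonneg h0 5
  interval_cases k <;> norm_num <;> nlinarith

lemma sum_card_inter_schurTriple_le {n : ℕ} {i : ℕ × ℕ} (hi : i ∈ schurPairs n) :
    ∑ j ∈ schurPairs n, #(schurTriple i ∩ schurTriple j) ≤ 9 * n := by
  calc ∑ j ∈ schurPairs n, #(schurTriple i ∩ schurTriple j)
      = ∑ v ∈ schurTriple i, #{j ∈ schurPairs n | v ∈ schurTriple j} := by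
        simp only [← filter_mem_eq_inter, card_filter]
        exact sum_comm
    _ ≤ ∑ _v ∈ schurTriple i, 3 * n := sum_le_sum fun v _ => card_schurPairs_filter_mem_le n v
    _ = 9 * n := by rw [sum_const, card_schurTriple hi, smul_eq_mul]; ring

lemma sum_card_offDiag_inter_schurTriple_le {n : ℕ} {i : ℕ × ℕ} (hi : i ∈ schurPairs n) :
    ∑ j ∈ schurPairs n, #(schurTriple i ∩ schurTriple j).offDiag ≤ 36 := by
  have hoff : ∀ j, (schurTriple i ∩ schurTriple j).offDiag =
      {w ∈ (schurTriple i).offDiag | w.1 ∈ schurTriple j ∧ w.2 ∈ schurTriple j} := by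
    intro j
    ext w
    simp only [mem_offDiag, mem_inter, mem_filter]
    tauto
  calc ∑ j ∈ schurPairs n, #(schurTriple i ∩ schurTriple j).offDiag
      = ∑ w ∈ (schurTriple i).offDiag,
          #{j ∈ schurPairs n | w.1 ∈ schurTriple j ∧ w.2 ∈ schurTriple j} := by
        simp only [hoff, card_filter]
        exact sum_comm
    _ ≤ ∑ _w ∈ (schurTriple i).offDiag, 6 := sum_le_sum fun w hw =>
        card_schurPairs_filter_mem_mem_le n (mem_offDiag.1 hw).2.2
    _ = 36 := by rw [sum_const, offDiag_card, card_schurTriple hi, smul_eq_mul]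

lemma sum_pow_card_schurTriple_le (n : ℕ) {p : ℝ} (h0 : 0 ≤ p) :
    ∑ i ∈ schurPairs n, p ^ (schurTriple i).card ≤ (n : ℝ) ^ 2 * p ^ 3 := by
  have h : ∀ i ∈ schurPairs n, p ^ (schurTriple i).card = p ^ 3 := fun i hi => by
    rw [card_schurTriple hi]
  rw [sum_congr rfl h, sum_const, nsmul_eq_mul]
  exact mul_le_mul_of_nonneg_right (mod_cast card_schurPairs_le n) (pow_nonneg h0 3)

lemma variance_schurTriple_le (n : ℕ) {p : ℝ} (h0 : 0 ≤ p) (h1 : p ≤ 1) :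
    binomMean (Icc 1 n) p (fun S => (containedCount (schurPairs n) schurTriple S
      - ∑ i ∈ schurPairs n, p ^ (schurTriple i).card) ^ 2) ≤
      (n : ℝ) ^ 2 * (9 * n * p ^ 5 + 36 * p ^ 3) := by
  rw [binomMean_containedCount_sub_sq p fun i hi => schurTriple_subset hi]
  have h3 : 0 ≤ p ^ 3 := pow_nonneg h0 3
  have h5 : 0 ≤ p ^ 5 := pow_nonneg h0 5
  have hi : ∀ i ∈ schurPairs n, ∑ j ∈ schurPairs n, (p ^ (schurTriple i ∪ schurTriple j).card
      - p ^ (schurTriple i).card * p ^ (schurTriple j).card) ≤ 9 * n * p ^ 5 + 36 * p ^ 3 := by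
    intro i hi
    refine (sum_le_sum fun j hj =>
      covariance_le (card_schurTriple hi) (card_schurTriple hj) h0 h1).trans ?_
    rw [sum_add_distrib, ← sum_mul, ← sum_mul]
    gcongr
    · exact_mod_cast sum_card_inter_schurTriple_le hi
    · exact_mod_cast sum_card_offDiag_inter_schurTriple_le hi
  refine (sum_le_sum hi).trans ?_
  rw [sum_const, nsmul_eq_mul]
  exact mul_le_mul_of_nonneg_right (mod_cast card_schurPairs_le n) (by positivity)

/-- Deleting one element per triple leaves a sum-free set, so `S` must have many triples. -/
lemma lt_containedCount_of_forall_hasSchurTriple {n : ℕ} {δ : ℝ} {S : Finset ℕ}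
    (hS : S ⊆ Icc 1 n)
    (h : ∀ Y ⊆ S, (1 - δ) * (S.card : ℝ) ≤ (Y.card : ℝ) → HasSchurTriple Y) :
    δ * S.card < containedCount (schurPairs n) schurTriple S := by
  obtain ⟨Y, hYS, hY, hcard⟩ := exists_subset_not_hasSchurTriple hS
  by_contra! hle
  exact hY (h Y hYS (by linarith))

lemma binomProb_schur_le_first_moment (n : ℕ) {δ p : ℝ} (hδ : 0 ≤ δ) (h0 : 0 ≤ p)
    (h1 : p ≤ 1) :
    binomProb (Icc 1 n) p
      (fun S => ∀ Y ⊆ S, (1 - δ) * (S.card : ℝ) ≤ (Y.card : ℝ) → HasSchurTriple Y) ≤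
      (n : ℝ) ^ 2 * p ^ 3 := by
  refine (binomProb_le_binomMean h0 h1 (f := containedCount (schurPairs n) schurTriple)
    (fun S => ?_) fun S hS h => ?_).trans ?_
  · rw [containedCount_eq_card]
    positivity
  · have := (mul_nonneg hδ S.card.cast_nonneg).trans_lt
      (lt_containedCount_of_forall_hasSchurTriple hS h)
    rw [containedCount_eq_card] at this ⊢
    exact_mod_cast this
  · rw [binomMean_containedCount p fun i hi => schurTriple_subset hi]
    exact sum_pow_card_schurTriple_le n h0

lemma binomProb_schur_le_second_moment {n : ℕ} (hn : 0 < n) {δ p : ℝ} (hδ : 0 < δ)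
    (h0 : 0 < p) (h1 : p ≤ 1) (hp : n * p ^ 2 ≤ δ / 4) :
    binomProb (Icc 1 n) p
      (fun S => ∀ Y ⊆ S, (1 - δ) * (S.card : ℝ) ≤ (Y.card : ℝ) → HasSchurTriple Y) ≤
      4 / (n * p) + 16 / δ ^ 2 * (9 * (n * p ^ 3) + 36 * p) := by
  set μ := ∑ i ∈ schurPairs n, p ^ (schurTriple i).card
  have hnp : 0 < n * p := by positivity
  have hμle : μ ≤ δ / 4 * (n * p) := by
    refine (sum_pow_card_schurTriple_le n h0.le).trans ?_
    calc (n : ℝ) ^ 2 * p ^ 3 = n * p ^ 2 * (n * p) := by ring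
      _ ≤ _ := by gcongr
  refine (binomProb_le_binomMean h0.le h1
    (f := fun S => 4 / (n * p) ^ 2 * ((S.card : ℝ) - (Icc 1 n).card * p) ^ 2 +
      16 / (δ * (n * p)) ^ 2 * (containedCount (schurPairs n) schurTriple S - μ) ^ 2)
    (fun S => by positivity) fun S hS h => ?_).trans ?_
  · have hlt := lt_containedCount_of_forall_hasSchurTriple hS h
    simp only [Nat.card_Icc, Nat.add_sub_cancel]
    set X := containedCount (schurPairs n) schurTriple S
    rcases le_or_gt (S.card : ℝ) (n * p / 2) with hc | hc
    · have : 1 ≤ 4 / (n * p) ^ 2 * ((S.card : ℝ) - n * p) ^ 2 := by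
        rw [div_mul_eq_mul_div, one_le_div (by positivity)]
        nlinarith
      have : 0 ≤ 16 / (δ * (n * p)) ^ 2 * (X - μ) ^ 2 := by positivity
      linarith
    · have hX : δ * (n * p) / 4 ≤ X - μ := by nlinarith
      have : 1 ≤ 16 / (δ * (n * p)) ^ 2 * (X - μ) ^ 2 := by
        rw [div_mul_eq_mul_div, one_le_div (by positivity)]
        have : (δ * (n * p) / 4) ^ 2 ≤ (X - μ) ^ 2 := by gcongr
        linarith
      have : 0 ≤ 4 / (n * p) ^ 2 * ((S.card : ℝ) - n * p) ^ 2 := by positivity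
      linarith
  · rw [binomMean_add, binomMean_const_mul, binomMean_const_mul, binomMean_card_sub_sq]
    simp only [Nat.card_Icc, Nat.add_sub_cancel]
    gcongr ?_ + ?_
    · calc 4 / (n * p) ^ 2 * (n * (p - p ^ 2)) ≤ 4 / (n * p) ^ 2 * (n * p) := by
            gcongr
            nlinarith
        _ = 4 / (n * p) := by field_simp
    · refine (mul_le_mul_of_nonneg_left (variance_schurTriple_le n h0.le h1)
        (by positivity)).trans_eq ?_
      field_simp

end SchurTriples

/-- The 0-statement for the extremal property of Schur's equation in random subsets. -/
theorem schur_zero_statement (ε : ℝ) (hε0 : 0 < ε) (hε1 : ε < 1 / 2) :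
    ∃ c : ℝ, 0 < c ∧ ∀ q : ℕ → ℝ, (∀ n, 0 ≤ q n ∧ q n ≤ 1) →
      (∀ n : ℕ, q n ≤ c * (n : ℝ) ^ (-(1 : ℝ) / 2)) →
      Tendsto (fun n => binomProb (Finset.Icc 1 n) (q n)
        (fun S => ∀ Y ⊆ S, (1 / 2 + ε) * (S.card : ℝ) ≤ (Y.card : ℝ) → HasSchurTriple Y))
        atTop (nhds 0) := by
  set δ := 1 / 2 - ε with hδ
  have hδ0 : 0 < δ := by linarith
  refine ⟨δ / 4, by positivity, fun q hq hqc => ?_⟩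
  rw [show (1 / 2 + ε) = 1 - δ by rw [hδ]; ring]
  have hlim : Tendsto (fun n : ℕ => 4 * (n : ℝ) ^ (-(1 / 6 : ℝ)) +
      (1 + 720 / δ ^ 2) * (n : ℝ) ^ (-(1 / 2 : ℝ))) atTop (nhds 0) := by
    have h6 := ((tendsto_rpow_neg_atTop (y := 1 / 6) (by norm_num)).comp
      (tendsto_natCast_atTop_atTop (R := ℝ))).const_mul 4
    have h2 := ((tendsto_rpow_neg_atTop (y := 1 / 2) (by norm_num)).comp
      (tendsto_natCast_atTop_atTop (R := ℝ))).const_mul (1 + 720 / δ ^ 2)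
    simpa using h6.add h2
  refine squeeze_zero' (.of_forall fun n => binomProb_nonneg (hq n).1 (hq n).2 _) ?_ hlim
  filter_upwards [eventually_gt_atTop 0] with n hn
  obtain ⟨h0, h1⟩ := hq n
  have hn' : (0 : ℝ) < n := mod_cast hn
  set r := (n : ℝ) ^ (-(1 / 2 : ℝ)) with hr
  have hr0 : 0 < r := Real.rpow_pos_of_pos hn' _
  have hr2 : n * r ^ 2 = 1 := by
    rw [hr, ← Real.rpow_natCast, ← Real.rpow_mul hn'.le,
      show -(1 / 2 : ℝ) * (2 : ℕ) = -1 by norm_num, Real.rpow_neg_one, mul_inv_cancel₀ hn'.ne']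
  set s := (n : ℝ) ^ (-(1 / 6 : ℝ)) with hs
  have hs0 : 0 < s := Real.rpow_pos_of_pos hn' _
  have hs3 : s ^ 3 = r := by
    rw [hs, hr, ← Real.rpow_natCast, ← Real.rpow_mul hn'.le]
    norm_num
  have hqr : q n ≤ δ / 4 * r := by
    have := hqc n
    rwa [show -(1 : ℝ) / 2 = -(1 / 2) by ring] at this
  have hqr' : q n ≤ r := hqr.trans (by nlinarith)
  have hnq : n * q n ^ 2 ≤ δ / 4 := by
    calc n * q n ^ 2 ≤ n * (δ / 4 * r) ^ 2 := by gcongr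
      _ = (δ / 4) ^ 2 * (n * r ^ 2) := by ring
      _ ≤ δ / 4 := by rw [hr2]; nlinarith
  rcases le_or_gt (n * q n * s) 1 with hsmall | hlarge
  · refine (binomProb_schur_le_first_moment n hδ0.le h0 h1).trans ?_
    have hcube : (n * q n * s) ^ 3 ≤ 1 := pow_le_one₀ (by positivity) hsmall
    have : (n : ℝ) ^ 2 * q n ^ 3 ≤ r := by
      calc (n : ℝ) ^ 2 * q n ^ 3 = (n : ℝ) ^ 2 * q n ^ 3 * (n * r ^ 2) := by rw [hr2, mul_one]
        _ = (n * q n * s) ^ 3 * r := by rw [mul_pow _ s, hs3]; ring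
        _ ≤ r := mul_le_of_le_one_left hr0.le hcube
    have : 0 ≤ 720 / δ ^ 2 * r := by positivity
    linarith
  · have hq0 : 0 < q n := h0.lt_of_ne fun h => by rw [← h] at hlarge; norm_num at hlarge
    refine (binomProb_schur_le_second_moment hn hδ0 hq0 h1 hnq).trans ?_
    have h4 : 4 / (n * q n) ≤ 4 * s := by
      rw [div_le_iff₀ (by positivity)]
      linarith
    have h3 : n * q n ^ 3 ≤ r := by
      calc n * q n ^ 3 = n * q n ^ 2 * q n := by ring
        _ ≤ 1 * r := by
          gcongr
          linarith
        _ = r := one_mul r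
    have h5 : 16 / δ ^ 2 * (9 * (n * q n ^ 3) + 36 * q n) ≤ 16 / δ ^ 2 * (9 * r + 36 * r) := by
      gcongr
    have : 16 / δ ^ 2 * (9 * r + 36 * r) = 720 / δ ^ 2 * r := by ring
    linarith
end
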